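/- Let G be a finite abelian group isomorphic to ℤ_{n_1} ⊕ … ⊕ ℤ_{n_k}, where each n_i ≥ 2 and n_{i+1} divides n_i for all 1 ≤ i ≤ k−1. If k ≥ 3 and n_1 = n_2 = n_3, then G is S_2-capable. -/

import Mathlib

/-- The commutator `[a,b] = a⁻¹ * b⁻¹ * a * b`. -/
def pcomm {E : Type} [Group E] (a b : E) : E := a⁻¹ * b⁻¹ * a * b

/-- The word `w(x,y,z,u) = [[x,y],[z,u]]` defining the variety `S_2` of metabelian groups. -/
def metaW {E : Type} [Group E] (x y z u : E) : E := pcomm (pcomm x y) (pcomm z u)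

/-- The marginal set of a group `E` with respect to the variety `S_2` of metabelian
groups: all `a ∈ E` such that replacing any one argument `g` of `w` by `g * a`
leaves the value of `w` unchanged. -/
def s2MarginalSet (E : Type) [Group E] : Set E :=
  {a : E | ∀ x y z u : E,
    metaW (x * a) y z u = metaW x y z u ∧
    metaW x (y * a) z u = metaW x y z u ∧
    metaW x y (z * a) u = metaW x y z u ∧
    metaW x y z (u * a) = metaW x y z u}

/-- `G` is `S_2`-capable if `G ≅ E / V*(E)` for some group `E`, where `V*(E)` is the
marginal (normal) subgroup of `E` with respect to the variety of metabelian groups,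
i.e. the normal subgroup whose underlying set is `s2MarginalSet E`. -/
def IsS2Capable (G : Type) [Group G] : Prop :=
  ∃ (E : Type) (_ : Group E) (H : Subgroup E) (_ : H.Normal),
    (H : Set E) = s2MarginalSet E ∧ Nonempty (G ≃* E ⧸ H)

/-- Unitriangular `5 × 5` matrices over `R`, by entries above the diagonal. -/
@[ext] structure UT5 (R : Type) where
  a12 : R
  a23 : R
  a34 : R
  a45 : R
  a13 : R
  a24 : R
  a35 : R
  a14 : R
  a25 : R
  a15 : R

namespace UT5

variable {R : Type} [CommRing R]

instance : Mul (UT5 R) := ⟨fun x y =>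
  { a12 := x.a12 + y.a12
    a23 := x.a23 + y.a23
    a34 := x.a34 + y.a34
    a45 := x.a45 + y.a45
    a13 := x.a13 + x.a12 * y.a23 + y.a13
    a24 := x.a24 + x.a23 * y.a34 + y.a24
    a35 := x.a35 + x.a34 * y.a45 + y.a35
    a14 := x.a14 + x.a13 * y.a34 + x.a12 * y.a24 + y.a14
    a25 := x.a25 + x.a24 * y.a45 + x.a23 * y.a35 + y.a25
    a15 := x.a15 + x.a14 * y.a45 + x.a13 * y.a35 + x.a12 * y.a25 + y.a15 }⟩

instance : One (UT5 R) := ⟨⟨0, 0, 0, 0, 0, 0, 0, 0, 0, 0⟩⟩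

instance : Inv (UT5 R) := ⟨fun x =>
  { a12 := -x.a12
    a23 := -x.a23
    a34 := -x.a34
    a45 := -x.a45
    a13 := -x.a13 + x.a12 * x.a23
    a24 := -x.a24 + x.a23 * x.a34
    a35 := -x.a35 + x.a34 * x.a45
    a14 := -x.a14 + x.a13 * x.a34 + x.a12 * x.a24 - x.a12 * x.a23 * x.a34
    a25 := -x.a25 + x.a24 * x.a45 + x.a23 * x.a35 - x.a23 * x.a34 * x.a45
    a15 := -x.a15 + x.a14 * x.a45 + x.a13 * x.a35 + x.a12 * x.a25
      - x.a13 * x.a34 * x.a45 - x.a12 * x.a24 * x.a45 - x.a12 * x.a23 * x.a35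
      + x.a12 * x.a23 * x.a34 * x.a45 }⟩

@[simp] lemma mul_a12 (x y : UT5 R) : (x * y).a12 = x.a12 + y.a12 := rfl
@[simp] lemma mul_a23 (x y : UT5 R) : (x * y).a23 = x.a23 + y.a23 := rfl
@[simp] lemma mul_a34 (x y : UT5 R) : (x * y).a34 = x.a34 + y.a34 := rfl
@[simp] lemma mul_a45 (x y : UT5 R) : (x * y).a45 = x.a45 + y.a45 := rfl
@[simp] lemma mul_a13 (x y : UT5 R) : (x * y).a13 = x.a13 + x.a12 * y.a23 + y.a13 := rfl
@[simp] lemma mul_a24 (x y : UT5 R) : (x * y).a24 = x.a24 + x.a23 * y.a34 + y.a24 := rfl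
@[simp] lemma mul_a35 (x y : UT5 R) : (x * y).a35 = x.a35 + x.a34 * y.a45 + y.a35 := rfl
@[simp] lemma mul_a14 (x y : UT5 R) : (x * y).a14 = x.a14 + x.a13 * y.a34 + x.a12 * y.a24 + y.a14 := rfl
@[simp] lemma mul_a25 (x y : UT5 R) : (x * y).a25 = x.a25 + x.a24 * y.a45 + x.a23 * y.a35 + y.a25 := rfl
@[simp] lemma mul_a15 (x y : UT5 R) : (x * y).a15 = x.a15 + x.a14 * y.a45 + x.a13 * y.a35 + x.a12 * y.a25 + y.a15 := rfl
@[simp] lemma one_a12 : (1 : UT5 R).a12 = 0 := rfl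
@[simp] lemma one_a23 : (1 : UT5 R).a23 = 0 := rfl
@[simp] lemma one_a34 : (1 : UT5 R).a34 = 0 := rfl
@[simp] lemma one_a45 : (1 : UT5 R).a45 = 0 := rfl
@[simp] lemma one_a13 : (1 : UT5 R).a13 = 0 := rfl
@[simp] lemma one_a24 : (1 : UT5 R).a24 = 0 := rfl
@[simp] lemma one_a35 : (1 : UT5 R).a35 = 0 := rfl
@[simp] lemma one_a14 : (1 : UT5 R).a14 = 0 := rfl
@[simp] lemma one_a25 : (1 : UT5 R).a25 = 0 := rfl
@[simp] lemma one_a15 : (1 : UT5 R).a15 = 0 := rfl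
@[simp] lemma inv_a12 (x : UT5 R) : (x⁻¹).a12 = -x.a12 := rfl
@[simp] lemma inv_a23 (x : UT5 R) : (x⁻¹).a23 = -x.a23 := rfl
@[simp] lemma inv_a34 (x : UT5 R) : (x⁻¹).a34 = -x.a34 := rfl
@[simp] lemma inv_a45 (x : UT5 R) : (x⁻¹).a45 = -x.a45 := rfl
@[simp] lemma inv_a13 (x : UT5 R) : (x⁻¹).a13 = -x.a13 + x.a12 * x.a23 := rfl
@[simp] lemma inv_a24 (x : UT5 R) : (x⁻¹).a24 = -x.a24 + x.a23 * x.a34 := rfl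
@[simp] lemma inv_a35 (x : UT5 R) : (x⁻¹).a35 = -x.a35 + x.a34 * x.a45 := rfl
@[simp] lemma inv_a14 (x : UT5 R) : (x⁻¹).a14 = -x.a14 + x.a13 * x.a34 + x.a12 * x.a24 - x.a12 * x.a23 * x.a34 := rfl
@[simp] lemma inv_a25 (x : UT5 R) : (x⁻¹).a25 = -x.a25 + x.a24 * x.a45 + x.a23 * x.a35 - x.a23 * x.a34 * x.a45 := rfl
@[simp] lemma inv_a15 (x : UT5 R) : (x⁻¹).a15 = -x.a15 + x.a14 * x.a45 + x.a13 * x.a35 + x.a12 * x.a25 - x.a13 * x.a34 * x.a45 - x.a12 * x.a24 * x.a45 - x.a12 * x.a23 * x.a35 + x.a12 * x.a23 * x.a34 * x.a45 := rfl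

instance : Group (UT5 R) := Group.ofLeftAxioms
  (by intro x y z; ext <;> simp <;> ring)
  (by intro x; ext <;> simp)
  (by intro x; ext <;> simp <;> ring)

/-- The skew form of the first two superdiagonal entries. -/
def al (x y : UT5 R) : R := x.a12 * y.a23 - y.a12 * x.a23

/-- The skew form of the last two superdiagonal entries. -/
def be (x y : UT5 R) : R := x.a34 * y.a45 - y.a34 * x.a45

lemma pcomm_spec (x y : UT5 R) :
    (pcomm x y).a12 = 0 ∧ (pcomm x y).a23 = 0 ∧ (pcomm x y).a34 = 0 ∧ (pcomm x y).a45 = 0 ∧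
    (pcomm x y).a13 = al x y ∧ (pcomm x y).a35 = be x y := by
  refine ⟨?_, ?_, ?_, ?_, ?_, ?_⟩ <;> simp [pcomm, al, be] <;> ring

lemma pcomm_deep (x y : UT5 R)
    (hx1 : x.a12 = 0) (hx2 : x.a23 = 0) (hx3 : x.a34 = 0) (hx4 : x.a45 = 0)
    (hy1 : y.a12 = 0) (hy2 : y.a23 = 0) (hy3 : y.a34 = 0) (hy4 : y.a45 = 0) :
    pcomm x y = ⟨0, 0, 0, 0, 0, 0, 0, 0, 0, x.a13 * y.a35 - y.a13 * x.a35⟩ := by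
  ext <;> simp [pcomm, hx1, hx2, hx3, hx4, hy1, hy2, hy3, hy4] <;> ring

lemma metaW_eq (x y z u : UT5 R) :
    metaW x y z u = ⟨0, 0, 0, 0, 0, 0, 0, 0, 0, al x y * be z u - al z u * be x y⟩ := by
  obtain ⟨h1, h2, h3, h4, h5, h6⟩ := pcomm_spec x y
  obtain ⟨g1, g2, g3, g4, g5, g6⟩ := pcomm_spec z u
  rw [metaW, pcomm_deep _ _ h1 h2 h3 h4 g1 g2 g3 g4, h5, h6, g5, g6]

/-- The unitriangular matrix with prescribed superdiagonal and zero elsewhere. -/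
def sd (p q r s : R) : UT5 R := ⟨p, q, r, s, 0, 0, 0, 0, 0, 0⟩

end UT5

lemma metaW_map {E F : Type} [Group E] [Group F] (f : E →* F) (x y z u : E) :
    f (metaW x y z u) = metaW (f x) (f y) (f z) (f u) := by
  simp [metaW, pcomm]

lemma metaW_comm {E : Type} [CommGroup E] (x y z u : E) : metaW x y z u = 1 := by
  simp [metaW, pcomm]

/-- The group used for capability: pairs of a vector and matrices with compatible superdiagonals. -/
def capGroup {V R I : Type} [AddCommGroup V] [CommRing R] (p q r s : I → V →+ R) :
    Subgroup (Multiplicative V × (I → UT5 R)) where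
  carrier := {e | ∀ i, (e.2 i).a12 = p i e.1.toAdd ∧ (e.2 i).a23 = q i e.1.toAdd ∧
    (e.2 i).a34 = r i e.1.toAdd ∧ (e.2 i).a45 = s i e.1.toAdd}
  mul_mem' := by
    intro a b ha hb i
    obtain ⟨h1, h2, h3, h4⟩ := ha i
    obtain ⟨g1, g2, g3, g4⟩ := hb i
    simp [h1, h2, h3, h4, g1, g2, g3, g4]
  one_mem' := by intro i; simp
  inv_mem' := by
    intro a ha i
    obtain ⟨h1, h2, h3, h4⟩ := ha i
    simp [h1, h2, h3, h4]

lemma capable_of_forms {V R I : Type} [AddCommGroup V] [CommRing R] (p q r s : I → V →+ R)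
    (hnd : ∀ v : V, (∀ i, ∀ y z u : V,
      (p i v * q i y - p i y * q i v) * (r i z * s i u - r i u * s i z)
      - (p i z * q i u - p i u * q i z) * (r i v * s i y - r i y * s i v) = 0) → v = 0) :
    IsS2Capable (Multiplicative V) := by
  let E := capGroup p q r s
  let π : E →* Multiplicative V := (MonoidHom.fst _ _).comp E.subtype
  let ρ : I → E →* UT5 R := fun i =>
    ((Pi.evalMonoidHom (fun _ : I => UT5 R) i).comp (MonoidHom.snd _ _)).comp E.subtype
  have hext : ∀ e f : E, π e = π f → (∀ i, ρ i e = ρ i f) → e = f := by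
    intro e f h1 h2
    exact Subtype.ext (Prod.ext h1 (funext h2))
  have hmem : ∀ (e : E) (i : I), (ρ i e).a12 = p i (π e).toAdd ∧ (ρ i e).a23 = q i (π e).toAdd ∧
      (ρ i e).a34 = r i (π e).toAdd ∧ (ρ i e).a45 = s i (π e).toAdd := fun e i => e.2 i
  let σ : V → E := fun v => ⟨(Multiplicative.ofAdd v,
    fun i => UT5.sd (p i v) (q i v) (r i v) (s i v)), fun i => ⟨rfl, rfl, rfl, rfl⟩⟩
  have hπσ : ∀ v, π (σ v) = Multiplicative.ofAdd v := fun v => rfl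
  have hπ : Function.Surjective π := fun v => ⟨σ v.toAdd, rfl⟩
  have hal : ∀ i (x y : E), UT5.al (ρ i x) (ρ i y) =
      p i (π x).toAdd * q i (π y).toAdd - p i (π y).toAdd * q i (π x).toAdd := by
    intro i x y
    rw [UT5.al, (hmem x i).1, (hmem y i).1, (hmem x i).2.1, (hmem y i).2.1]
  have hbe : ∀ i (x y : E), UT5.be (ρ i x) (ρ i y) =
      r i (π x).toAdd * s i (π y).toAdd - r i (π y).toAdd * s i (π x).toAdd := by
    intro i x y
    rw [UT5.be, (hmem x i).2.2.1, (hmem y i).2.2.1, (hmem x i).2.2.2, (hmem y i).2.2.2]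
  have hcongr : ∀ x y z u x' y' z' u' : E, π x = π x' → π y = π y' → π z = π z' → π u = π u' →
      metaW x y z u = metaW x' y' z' u' := by
    intro x y z u x' y' z' u' hx hy hz hu
    apply hext
    · rw [metaW_map, metaW_map, metaW_comm, metaW_comm]
    · intro i
      rw [metaW_map, metaW_map, UT5.metaW_eq, UT5.metaW_eq]
      simp only [hal, hbe, hx, hy, hz, hu]
  refine ⟨E, inferInstance, π.ker, inferInstance, ?_,
    ⟨(QuotientGroup.quotientKerEquivOfSurjective π hπ).symm⟩⟩
  ext a
  constructor
  · intro ha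
    have ha' : π a = 1 := ha
    intro x y z u
    refine ⟨?_, ?_, ?_, ?_⟩ <;> apply hcongr <;> simp [ha']
  · intro ha
    change π a = 1
    have : (π a).toAdd = 0 := by
      apply hnd
      intro i y z u
      have h := congrArg (fun e => (ρ i e).a15) (ha 1 (σ y) (σ z) (σ u)).1
      simp only [metaW_map, UT5.metaW_eq, hal, hbe, one_mul, hπσ, map_one, toAdd_one, map_zero,
        toAdd_ofAdd] at h
      rw [h]; simp [UT5.al, UT5.be]
    exact this

lemma exists_coord (m N : ℕ) (hN : N ≠ 0) (h : m ∣ N) :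
    ∃ c : ZMod m →+ ZMod N, Function.Injective c ∧ (m = N → c 1 = 1) := by
  obtain ⟨d, rfl⟩ := h
  have hd : d ≠ 0 := by rintro rfl; simp at hN
  have hm : m ≠ 0 := by rintro rfl; simp at hN
  let f : ℤ →+ ZMod (m * d) := zmultiplesHom _ (d : ZMod (m * d))
  have hf : ∀ z : ℤ, f z = ((z * d : ℤ) : ZMod (m * d)) := by intro z; simp [f]
  have hfm : f m = 0 := by
    rw [hf, ZMod.intCast_zmod_eq_zero_iff_dvd]; push_cast; rfl
  refine ⟨ZMod.lift m ⟨f, hfm⟩, ?_, ?_⟩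
  · rw [ZMod.lift_injective]
    intro z hz
    have hz' : f z = 0 := hz
    rw [hf, ZMod.intCast_zmod_eq_zero_iff_dvd] at hz'
    rw [ZMod.intCast_zmod_eq_zero_iff_dvd]
    push_cast at hz'
    exact Int.dvd_of_mul_dvd_mul_right (by exact_mod_cast hd) hz'
  · intro h
    have hd1 : d = 1 := by
      apply Nat.eq_of_mul_eq_mul_left (Nat.pos_of_ne_zero hm); omega
    have := ZMod.lift_coe m ⟨f, hfm⟩ 1
    rw [Int.cast_one] at this
    rw [this]
    change f 1 = 1
    rw [hf, hd1]; simp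

lemma capable_congr {G K : Type} [Group G] [Group K] (e : G ≃* K) (h : IsS2Capable K) :
    IsS2Capable G := by
  obtain ⟨E, iE, H, hH, h1, ⟨f⟩⟩ := h
  exact ⟨E, iE, H, hH, h1, ⟨e.trans f⟩⟩

/-- If a finite abelian group `ℤ_{n_1} ⊕ … ⊕ ℤ_{n_k}` (each `n_i ≥ 2`, `n_{i+1} ∣ n_i`)
satisfies `k ≥ 3` and `n_1 = n_2 = n_3`, then it is `S_2`-capable. -/
theorem s2Capable_finite_abelian_sufficient (G : Type) [Group G]
    (k : ℕ) (n : Fin k → ℕ)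
    (hn : ∀ i : Fin k, 2 ≤ n i)
    (hdvd : ∀ i : Fin k, ∀ h : (i : ℕ) + 1 < k, n ⟨(i : ℕ) + 1, h⟩ ∣ n i)
    (hG : Nonempty (G ≃* Multiplicative ((i : Fin k) → ZMod (n i))))
    (hk : 3 ≤ k)
    (h12 : n ⟨0, by omega⟩ = n ⟨1, by omega⟩) (h23 : n ⟨1, by omega⟩ = n ⟨2, by omega⟩) :
    IsS2Capable G := by
  obtain ⟨e⟩ := hG
  apply capable_congr e
  set i0 : Fin k := ⟨0, by omega⟩ with hi0
  set i1 : Fin k := ⟨1, by omega⟩ with hi1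
  set i2 : Fin k := ⟨2, by omega⟩ with hi2
  have hN : n i0 ≠ 0 := by have := hn i0; omega
  have hdiv : ∀ m : ℕ, ∀ hm : m < k, n ⟨m, hm⟩ ∣ n i0 := by
    intro m
    induction m with
    | zero => intro hm; exact dvd_refl _
    | succ m ih => intro hm; exact (hdvd ⟨m, by omega⟩ hm).trans (ih (by omega))
  have hc : ∀ i : Fin k, ∃ c : ZMod (n i) →+ ZMod (n i0), Function.Injective c ∧
      (n i = n i0 → c 1 = 1) := fun i => exists_coord _ _ hN (hdiv i i.2)
  choose c hcinj hc1 using hc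
  have hjl : ∀ i : Fin k, ∃ j l : Fin k, j ≠ i ∧ l ≠ i ∧ j ≠ l ∧ n j = n i0 ∧ n l = n i0 := by
    have h01 : i0 ≠ i1 := by simp [hi0, hi1]
    have h02 : i0 ≠ i2 := by simp [hi0, hi2]
    have h12' : i1 ≠ i2 := by simp [hi1, hi2]
    intro i
    by_cases a0 : i = i0
    · exact ⟨i1, i2, a0 ▸ h01.symm, a0 ▸ h02.symm, h12', h12.symm, (h12.trans h23).symm⟩
    by_cases a1 : i = i1
    · exact ⟨i0, i2, a1 ▸ h01, a1 ▸ h12'.symm, h02, rfl, (h12.trans h23).symm⟩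
    · exact ⟨i0, i1, Ne.symm a0, Ne.symm a1, h01, rfl, h12.symm⟩
  choose j l hji hli hjl hnj hnl using hjl
  let x : Fin k → ((i : Fin k) → ZMod (n i)) →+ ZMod (n i0) := fun i =>
    (c i).comp (Pi.evalAddMonoidHom _ i)
  have hx : ∀ i v, x i v = c i (v i) := fun i v => rfl
  apply capable_of_forms (I := Fin k) x (fun i => x (j i)) (fun i => x (l i)) (fun i => x (j i))
  intro v hv
  funext i
  apply hcinj i
  have h := hv i (Pi.single (j i) 1) (Pi.single (l i) 1) (Pi.single (j i) 1)
  simp only [hx, Pi.single_eq_same, hc1 _ (hnj i), hc1 _ (hnl i),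
    Pi.single_eq_of_ne (hji i).symm, Pi.single_eq_of_ne (hli i).symm,
    Pi.single_eq_of_ne (hjl i), Pi.single_eq_of_ne (hjl i).symm, map_zero] at h
  simpa using h
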